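/- arXiv:1101.4818 — 2 statements merged into one kernel-verified Lean document; each statement's English description precedes it below -/
import Mathlib

section
/- Let r be a natural number, R = ℚ[x_1, …, x_r] the polynomial ring in r variables over ℚ, and regard ℚ as an R-module via the evaluation map at 0 (sending each x_i to 0). Then there is an exact sequence of R-modules 0 → F_r → F_{r-1} → ⋯ → F_1 → F_0 → ℚ → 0 in which each F_s is a finite free R-module of rank binom(r, s); consequently the projective dimension of the R-module ℚ is exactly r. -/
open CategoryTheory

/-- The `ℚ[x_1, …, x_r]`-module structure on `ℚ` given by evaluating all variables at `0`. -/
noncomputable def qModule (r : ℕ) : Module (MvPolynomial (Fin r) ℚ) ℚ :=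
  Module.compHom ℚ (MvPolynomial.eval (0 : Fin r → ℚ))

/-- `M` has projective dimension at most `n`: it admits a projective resolution
concentrated in degrees `0, …, n`. -/
def projDimLE (R : Type) [CommRing R] (M : ModuleCat R) (n : ℕ) : Prop :=
  ∃ P : ProjectiveResolution M, ∀ i : ℕ, n < i → Limits.IsZero (P.complex.X i)

open Function Abelian

universe u

section Koszul

variable {R : Type u} [CommRing R] {M N : Type u} [AddCommGroup M] [Module R M]
  [AddCommGroup N] [Module R N]

/-- `M` has a resolution by finite free modules whose ranks are given by `b`. -/
def HasFreeResolution (R : Type u) [CommRing R] (M : Type u) [AddCommGroup M] [Module R M]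
    (b : ℕ → ℕ) : Prop :=
  ∃ (d : ∀ s : ℕ, (Fin (b (s + 1)) → R) →ₗ[R] (Fin (b s) → R)) (ε : (Fin (b 0) → R) →ₗ[R] M),
    Surjective ε ∧ Exact (d 0) ε ∧ ∀ s : ℕ, Exact (d (s + 1)) (d s)

lemma HasFreeResolution.of_equiv {b c : ℕ → ℕ}
    (e : ∀ s, ((Fin (b s) → R) × (Fin (c s) → R)) ≃ₗ[R] (Fin (b s + c s) → R))
    (d : ∀ s : ℕ, ((Fin (b (s + 1)) → R) × (Fin (c (s + 1)) → R)) →ₗ[R]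
      ((Fin (b s) → R) × (Fin (c s) → R)))
    (ε : ((Fin (b 0) → R) × (Fin (c 0) → R)) →ₗ[R] M)
    (hε : Surjective ε) (h₀ : Exact (d 0) ε) (h : ∀ s, Exact (d (s + 1)) (d s)) :
    HasFreeResolution R M (fun s => b s + c s) := by
  refine ⟨fun s => (e s).toLinearMap ∘ₗ d s ∘ₗ (e (s + 1)).symm.toLinearMap,
    ε ∘ₗ (e 0).symm.toLinearMap, hε.comp (e 0).symm.surjective, fun y => ?_, fun s y => ?_⟩
  · simp only [LinearMap.comp_apply, LinearEquiv.coe_coe]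
    rw [h₀]
    constructor
    · rintro ⟨x, hx⟩
      exact ⟨e 1 x, by simp [hx]⟩
    · rintro ⟨x, rfl⟩
      exact ⟨(e 1).symm x, by simp⟩
  · simp only [LinearMap.comp_apply, LinearEquiv.coe_coe, LinearEquiv.map_eq_zero_iff]
    rw [h s]
    constructor
    · rintro ⟨x, hx⟩
      exact ⟨e (s + 2) x, by simp [hx]⟩
    · rintro ⟨x, rfl⟩
      exact ⟨(e (s + 2)).symm x, by simp⟩

/-- The ranks `b` moved up by one degree. -/
def shiftRank (b : ℕ → ℕ) : ℕ → ℕ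
  | 0 => 0
  | s + 1 => b s

/-- The differential of a complex of free modules moved up by one degree. -/
def shiftDiff {b : ℕ → ℕ} (d : ∀ s : ℕ, (Fin (b (s + 1)) → R) →ₗ[R] (Fin (b s) → R)) :
    ∀ s : ℕ, (Fin (shiftRank b (s + 1)) → R) →ₗ[R] (Fin (shiftRank b s) → R)
  | 0 => 0
  | s + 1 => d s

/-- The differential of the mapping cone of multiplication by `x` on a complex of free modules. -/
def coneDiff {b : ℕ → ℕ} (d : ∀ s : ℕ, (Fin (b (s + 1)) → R) →ₗ[R] (Fin (b s) → R)) (x : R)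
    (s : ℕ) : ((Fin (b (s + 1)) → R) × (Fin (shiftRank b (s + 1)) → R)) →ₗ[R]
      ((Fin (b s) → R) × (Fin (shiftRank b s) → R)) :=
  ((d s).coprod (x • (LinearMap.id : (Fin (b s) → R) →ₗ[R] _))).prod
    (-(shiftDiff d s ∘ₗ LinearMap.snd R _ _))

lemma coneDiff_apply {b : ℕ → ℕ} (d : ∀ s : ℕ, (Fin (b (s + 1)) → R) →ₗ[R] (Fin (b s) → R))
    (x : R) (s : ℕ) (p : Fin (b (s + 1)) → R) (q : Fin (b s) → R) :
    coneDiff d x s (p, q) = (d s p + x • q, -shiftDiff d s q) := rfl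

/-- The mapping cone of multiplication by a regular element `x` on a free resolution of `M`
resolves `M / xM`. -/
lemma HasFreeResolution.cone {b : ℕ → ℕ} (h : HasFreeResolution R M b) {x : R}
    (hx : IsSMulRegular M x) {π : M →ₗ[R] N} (hπ : Surjective π)
    (hxπ : Exact (LinearMap.lsmul R M x) π) :
    HasFreeResolution R N (fun s => b s + shiftRank b s) := by
  obtain ⟨d, ε, hε, h₀, hd⟩ := h
  refine .of_equiv
    (fun s => (LinearEquiv.sumArrowLequivProdArrow _ _ R R).symm.trans
      (LinearEquiv.funCongrLeft R R finSumFinEquiv.symm))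
    (coneDiff d x) (π ∘ₗ ε ∘ₗ LinearMap.fst R _ _)
    (hπ.comp (hε.comp Prod.fst_surjective)) ?_ ?_
  · rintro ⟨p, q⟩
    simp only [LinearMap.comp_apply, LinearMap.fst_apply]
    rw [hxπ]
    constructor
    · rintro ⟨m, hm⟩
      obtain ⟨m, rfl⟩ := hε m
      obtain ⟨a, ha⟩ := (h₀ (p - x • m)).1 (by simpa [sub_eq_zero] using hm.symm)
      refine ⟨(a, m), Prod.ext ?_ ?_⟩
      · simp [coneDiff_apply, ha]
      · exact funext fun i => i.elim0
    · rintro ⟨⟨a, (m : Fin (b 0) → R)⟩, hm⟩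
      refine ⟨ε m, ?_⟩
      replace hm := (coneDiff_apply d x 0 a m).symm.trans hm
      obtain ⟨rfl, rfl⟩ := Prod.ext_iff.1 hm
      simp [h₀.apply_apply_eq_zero]
  · intro s
    rintro ⟨p, (q : Fin (b s) → R)⟩
    change (d s p + x • q, -shiftDiff d s q) = 0 ↔ _
    constructor
    · intro hpq
      obtain ⟨h1, h2⟩ := Prod.ext_iff.1 hpq
      simp only [Prod.fst_zero, Prod.snd_zero] at h1 h2
      obtain ⟨q', hq'⟩ : ∃ q', d s q' = q := by
        cases s with
        | zero =>
          refine (h₀ q).1 (hx ?_)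
          have := congrArg ε h1
          simpa [h₀.apply_apply_eq_zero] using this
        | succ s =>
          exact (hd s q).1 (neg_eq_zero.1 h2)
      obtain ⟨p', hp'⟩ := (hd s (p + x • q')).1 (by rw [map_add, map_smul, hq', h1])
      refine ⟨(p', -q'), ?_⟩
      rw [coneDiff_apply]
      refine Prod.ext ?_ ?_
      · simp [hp']
      · change -(d s (-q')) = q
        rw [map_neg, neg_neg, hq']
    · rintro ⟨⟨p', (q' : Fin (b (s + 1)) → R)⟩, hpq⟩
      replace hpq := (coneDiff_apply d x (s + 1) p' q').symm.trans hpq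
      obtain ⟨rfl, rfl⟩ := Prod.ext_iff.1 hpq
      refine Prod.ext ?_ ?_
      · change d s (d (s + 1) p' + x • q') + x • (-(d s q')) = 0
        simp [(hd s).apply_apply_eq_zero]
      · change -(shiftDiff d s (-(d s q'))) = 0
        cases s with
        | zero => exact funext fun i => i.elim0
        | succ s =>
          change -(d s (-(d (s + 1) q'))) = 0
          simp [(hd s).apply_apply_eq_zero]

lemma choose_add_shiftRank (n : ℕ) :
    (fun s => n.choose s + shiftRank n.choose s) = (n + 1).choose := by
  funext s
  cases s with
  | zero => simp [shiftRank]
  | succ s => exact add_comm _ _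

lemma HasFreeResolution.self : HasFreeResolution R R (Nat.choose 0) := by
  have : ∀ s, Subsingleton (Fin (Nat.choose 0 (s + 1)) → R) := fun s =>
    ⟨fun a b => funext fun i => i.elim0⟩
  refine ⟨fun s => 0, LinearMap.proj (0 : Fin 1), fun a => ⟨fun _ => a, rfl⟩, fun y => ?_,
    fun s y => ?_⟩
  · constructor
    · intro hy
      refine ⟨0, funext fun i => ?_⟩
      obtain rfl : i = (0 : Fin 1) := Subsingleton.elim (α := Fin 1) _ _
      exact hy.symm
    · rintro ⟨x, rfl⟩
      rfl
  · exact ⟨fun _ => ⟨0, Subsingleton.elim _ _⟩, fun _ => rfl⟩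

lemma HasFreeResolution.congr {b : ℕ → ℕ} (h : HasFreeResolution R M b) (e : M ≃ₗ[R] N) :
    HasFreeResolution R N b := by
  obtain ⟨d, ε, hε, h₀, hd⟩ := h
  refine ⟨d, e.toLinearMap ∘ₗ ε, e.surjective.comp hε, fun y => ?_, hd⟩
  rw [← h₀]
  simp

/-- If `x` is regular on `M` and kills `L`, the connecting map of
`0 → M → M → M / xM → 0` embeds `Ext M L n` into `Ext (M / xM) L (n + 1)`. -/
lemma nontrivial_ext_succ {L : ModuleCat.{u} R} {x : R} (hL : ∀ l : L, x • l = 0)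
    (hx : IsSMulRegular M x) {π : M →ₗ[R] N} (hπ : Surjective π)
    (hxπ : Exact (LinearMap.lsmul R M x) π) {n : ℕ}
    (h : Nontrivial (Ext (ModuleCat.of R M) L n)) :
    Nontrivial (Ext (ModuleCat.of R N) L (n + 1)) := by
  let S : ShortComplex (ModuleCat.{u} R) :=
    ShortComplex.mk (x • 𝟙 (ModuleCat.of R M)) (ModuleCat.ofHom π) (by
      ext m
      exact hxπ.apply_apply_eq_zero m)
  have hS : S.ShortExact :=
    { exact := by
        rw [ShortComplex.ShortExact.moduleCat_exact_iff_function_exact]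
        exact hxπ
      mono_f := (ModuleCat.mono_iff_injective _).2 hx
      epi_g := (ModuleCat.epi_iff_surjective _).2 hπ }
  obtain ⟨α, hα⟩ := exists_ne (0 : Ext (ModuleCat.of R M) L n)
  refine nontrivial_of_ne (hS.extClass.comp (X := S.X₃) α (add_comm 1 n)) 0 fun h0 => hα ?_
  obtain ⟨β, hβ⟩ := Ext.contravariant_sequence_exact₁ hS L α (add_comm 1 n) h0
  have hL' : x • 𝟙 L = 0 := by
    ext l
    exact hL l
  rw [← hβ]
  change (Ext.mk₀ (x • 𝟙 (ModuleCat.of R M))).comp β _ = 0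
  rw [Ext.mk₀_smul, Ext.smul_comp, Ext.mk₀_id_comp, ← Ext.comp_mk₀_id β, ← Ext.comp_smul,
    ← Ext.mk₀_smul, hL', Ext.mk₀_zero, Ext.comp_zero]

end Koszul

section Variables

open MvPolynomial

variable {σ k : Type u} [CommRing k]

/-- A variable outside `s` is regular modulo the ideal generated by the variables in `s`. -/
lemma isSMulRegular_X_quotient_span {s : Set σ} {i : σ} (hi : i ∉ s) :
    IsSMulRegular (MvPolynomial σ k ⧸ Ideal.span ((X : σ → MvPolynomial σ k) '' s))
      (X i : MvPolynomial σ k) := by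
  rw [isSMulRegular_iff_right_eq_zero_of_smul]
  intro m hm
  obtain ⟨p, rfl⟩ := Ideal.Quotient.mk_surjective m
  change Ideal.Quotient.mk _ (X i * p) = 0 at hm
  rw [Ideal.Quotient.eq_zero_iff_mem, mem_ideal_span_X_image] at hm ⊢
  intro m hm'
  obtain ⟨j, hj, hji⟩ := hm (Finsupp.single i 1 + m) (by
    rwa [mem_support_iff, coeff_X_mul, ← mem_support_iff])
  refine ⟨j, hj, ?_⟩
  have : i ≠ j := fun h => hi (h ▸ hj)
  simpa [this] using hji

/-- The quotient by the ideal generated by finitely many variables is resolved by free modules of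
binomial ranks, and has nonzero `Ext` in top degree with values in modules killed by them. -/
lemma hasFreeResolution_and_nontrivial_ext_quotient_span_X
    (L : ModuleCat.{u} (MvPolynomial σ k)) [Nontrivial L]
    (hL : ∀ (i : σ) (l : L), (X i : MvPolynomial σ k) • l = 0) (s : Finset σ) :
    HasFreeResolution (MvPolynomial σ k)
      (MvPolynomial σ k ⧸ Ideal.span ((X : σ → MvPolynomial σ k) '' s)) s.card.choose ∧
    Nontrivial (Ext (ModuleCat.of (MvPolynomial σ k)
      (MvPolynomial σ k ⧸ Ideal.span ((X : σ → MvPolynomial σ k) '' s))) L s.card) := by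
  classical
  induction s using Finset.induction_on with
  | empty =>
    have e : (MvPolynomial σ k ⧸ Ideal.span ((X : σ → MvPolynomial σ k) '' (∅ : Finset σ))) ≃ₗ[
        MvPolynomial σ k] MvPolynomial σ k :=
      Submodule.quotEquivOfEqBot _ (by simp)
    refine ⟨HasFreeResolution.self.congr e.symm, ?_⟩
    obtain ⟨l, hl⟩ := exists_ne (0 : L)
    have : Nontrivial (ModuleCat.of (MvPolynomial σ k) (MvPolynomial σ k ⧸ Ideal.span
        ((X : σ → MvPolynomial σ k) '' (∅ : Finset σ))) ⟶ L) := by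
      refine nontrivial_of_ne
        (ModuleCat.ofHom ((LinearMap.toSpanSingleton _ L l) ∘ₗ e.toLinearMap)) 0 fun h => hl ?_
      have := congrArg (fun f => f.hom (e.symm 1)) h
      simpa using this
    exact Ext.homEquiv₀.nontrivial
  | insert i s hi ih =>
    have hle : Ideal.span ((X : σ → MvPolynomial σ k) '' s) ≤
        Ideal.span ((X : σ → MvPolynomial σ k) '' (insert i s : Finset σ)) :=
      Ideal.span_mono (Set.image_mono (by simp))
    have hx := isSMulRegular_X_quotient_span (k := k) (s := (s : Set σ)) (i := i)
      (by simpa using hi)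
    have hπ : Surjective (Submodule.factor hle) := Submodule.factor_surjective hle
    have hxπ : Exact (LinearMap.lsmul (MvPolynomial σ k)
        (MvPolynomial σ k ⧸ Ideal.span ((X : σ → MvPolynomial σ k) '' s)) (X i))
        (Submodule.factor hle) := by
      intro m
      obtain ⟨p, rfl⟩ := Ideal.Quotient.mk_surjective m
      change Ideal.Quotient.mk _ p = 0 ↔ _
      rw [Ideal.Quotient.eq_zero_iff_mem, Finset.coe_insert, Set.image_insert_eq,
        Ideal.mem_span_insert]
      constructor
      · rintro ⟨a, z, hz, rfl⟩
        refine ⟨Ideal.Quotient.mk _ a, ?_⟩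
        change Ideal.Quotient.mk _ (X i * a) = _
        rw [Ideal.Quotient.eq]
        simpa [mul_comm] using hz
      · rintro ⟨a, ha⟩
        obtain ⟨a, rfl⟩ := Ideal.Quotient.mk_surjective a
        change Ideal.Quotient.mk _ (X i * a) = _ at ha
        rw [eq_comm, Ideal.Quotient.eq] at ha
        exact ⟨a, _, ha, by ring⟩
    rw [Finset.card_insert_of_notMem hi, ← choose_add_shiftRank]
    exact ⟨ih.1.cone hx hπ hxπ, nontrivial_ext_succ (hL i) hx hπ hxπ ih.2⟩

end Variables

section Resolution

variable {R : Type} [CommRing R]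

/-- A free resolution with zero terms above degree `n` bounds the projective dimension by `n`. -/
lemma HasFreeResolution.projDimLE {M : ModuleCat.{0} R} {b : ℕ → ℕ} (h : HasFreeResolution R M b)
    {n : ℕ} (hb : ∀ i, n < i → b i = 0) : projDimLE R M n := by
  obtain ⟨d, ε, hε, h₀, hd⟩ := h
  let K : ChainComplex (ModuleCat.{0} R) ℕ :=
    ChainComplex.of (fun s => ModuleCat.of R (Fin (b s) → R)) (fun s => ModuleCat.ofHom (d s))
      (fun s => by
        ext1
        exact (hd s).linearMap_comp_eq_zero)
  have hK : ∀ s, K.d (s + 1) s = ModuleCat.ofHom (d s) := fun s => ChainComplex.of_d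
    (fun s => ModuleCat.of R (Fin (b s) → R)) (fun s => ModuleCat.ofHom (d s)) s
  have hz : K.d 1 0 ≫ ModuleCat.ofHom ε = 0 := by
    rw [hK]
    ext1
    exact h₀.linearMap_comp_eq_zero
  let P : ProjectiveResolution M :=
    { complex := K
      projective := fun s => by
        change Projective (ModuleCat.of R (Fin (b s) → R))
        rw [← IsProjective.iff_projective]
        infer_instance
      π := (ChainComplex.toSingle₀Equiv _ _).symm ⟨ModuleCat.ofHom ε, hz⟩
      quasiIso := ⟨fun s => by
        cases s with
        | zero =>
          rw [ChainComplex.quasiIsoAt₀_iff, ShortComplex.quasiIso_iff_of_zeros']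
          · refine (ShortComplex.exact_and_epi_g_iff_of_iso (S₂ := ShortComplex.mk _ _ hz) ?_).2
              ⟨?_, (ModuleCat.epi_iff_surjective _).2 hε⟩
            · exact ShortComplex.isoMk (Iso.refl _) (Iso.refl _) (Iso.refl _)
                ((Category.id_comp _).trans (Category.comp_id _).symm)
                ((Category.id_comp _).trans (Category.comp_id _).symm)
            · rw [ShortComplex.ShortExact.moduleCat_exact_iff_function_exact]
              simpa [hK] using h₀
          all_goals rfl
        | succ s =>
          rw [quasiIsoAt_iff_exactAt' _ _ (ChainComplex.exactAt_succ_single_obj _ _),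
            HomologicalComplex.exactAt_iff' _ (s + 2) (s + 1) s (by simp) (by simp),
            ShortComplex.ShortExact.moduleCat_exact_iff_function_exact]
          change Exact (K.d (s + 2) (s + 1)) (K.d (s + 1) s)
          rw [hK, hK]
          exact hd s⟩ }
  refine ⟨P, fun i hi => ?_⟩
  rw [ModuleCat.isZero_iff_subsingleton]
  change Subsingleton (Fin (b i) → R)
  rw [hb i hi]
  infer_instance

lemma le_of_projDimLE_of_nontrivial_ext {M L : ModuleCat.{0} R} {m n : ℕ}
    (h : Nontrivial (Ext M L m)) (hM : projDimLE R M n) : m ≤ n := by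
  obtain ⟨P, hP⟩ := hM
  by_contra! hlt
  obtain ⟨α, hα⟩ := exists_ne (0 : Ext M L m)
  obtain ⟨f, hf, rfl⟩ := P.extMk_surjective α (m + 1) rfl
  obtain rfl : f = 0 := (hP m hlt).eq_of_src _ _
  exact hα (P.extMk_zero _ rfl)

end Resolution

/-- `ℚ`, with all variables acting as zero, is the quotient by the ideal of all variables. -/
lemma nonempty_quotient_span_X_equiv (r : ℕ) :
    letI := qModule r
    Nonempty ((MvPolynomial (Fin r) ℚ ⧸ Ideal.span
      ((MvPolynomial.X : Fin r → MvPolynomial (Fin r) ℚ) ''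
      (Finset.univ : Finset (Fin r)))) ≃ₗ[MvPolynomial (Fin r) ℚ] ℚ) := by
  let := qModule r
  let f : MvPolynomial (Fin r) ℚ →ₗ[MvPolynomial (Fin r) ℚ] ℚ := LinearMap.toSpanSingleton _ ℚ 1
  have hf : ∀ p, f p = MvPolynomial.constantCoeff p := fun p => by
    rw [← MvPolynomial.eval_zero]
    exact mul_one _
  have hker : Ideal.span ((MvPolynomial.X : Fin r → MvPolynomial (Fin r) ℚ) ''
      (Finset.univ : Finset (Fin r))) = LinearMap.ker f := by
    ext p
    rw [MvPolynomial.mem_ideal_span_X_image, LinearMap.mem_ker, hf,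
      MvPolynomial.constantCoeff_eq, ← MvPolynomial.notMem_support_iff]
    constructor
    · intro h h0
      obtain ⟨i, -, hi⟩ := h 0 h0
      exact hi rfl
    · intro h m hm
      obtain ⟨i, hi⟩ := Finsupp.ne_iff.1 (show m ≠ 0 from fun h0 => h (h0 ▸ hm))
      exact ⟨i, by simp, hi⟩
  exact ⟨(Submodule.quotEquivOfEq _ _ hker).trans (f.quotKerEquivOfSurjective fun q =>
    ⟨MvPolynomial.C q, by rw [hf, MvPolynomial.constantCoeff_C]⟩)⟩

/-- Let `R = ℚ[x_1, …, x_r]` and regard `ℚ` as an `R`-module via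
evaluation at `0`.  There is an exact sequence of `R`-modules
`0 → F_r → F_{r-1} → ⋯ → F_1 → F_0 → ℚ → 0` in which each `F_s` is a finite free
`R`-module of rank `binom(r,s)` (here `F_s = Fin (r.choose s) → R`); consequently the
projective dimension of the `R`-module `ℚ` is exactly `r`. -/
theorem stmt4 (r : ℕ) :
    letI R := MvPolynomial (Fin r) ℚ
    letI : Module R ℚ := qModule r
    (∃ (d : ∀ s : ℕ, (Fin (r.choose (s + 1)) → R) →ₗ[R] (Fin (r.choose s) → R))
       (ε : (Fin (r.choose 0) → R) →ₗ[R] ℚ),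
        Function.Surjective ε ∧
        LinearMap.ker ε = LinearMap.range (d 0) ∧
        (∀ s : ℕ, s + 1 < r → LinearMap.ker (d s) = LinearMap.range (d (s + 1))) ∧
        (∀ s : ℕ, r ≤ s + 1 → LinearMap.ker (d s) = ⊥)) ∧
    projDimLE R (ModuleCat.of R ℚ) r ∧
    (∀ n : ℕ, projDimLE R (ModuleCat.of R ℚ) n → r ≤ n) := by
  let := qModule r
  obtain ⟨e⟩ := nonempty_quotient_span_X_equiv r
  obtain ⟨hres, hext⟩ := hasFreeResolution_and_nontrivial_ext_quotient_span_X
    (ModuleCat.of (MvPolynomial (Fin r) ℚ) ℚ)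
    (fun i l => show MvPolynomial.eval (0 : Fin r → ℚ) (MvPolynomial.X i) * l = 0 by simp)
    Finset.univ
  rw [Finset.card_univ, Fintype.card_fin] at hres hext
  replace hres := hres.congr e
  refine ⟨?_, HasFreeResolution.projDimLE (M := ModuleCat.of _ ℚ) hres
    fun i hi => Nat.choose_eq_zero_of_lt hi, fun n hn => ?_⟩
  · obtain ⟨d, ε, hε, h₀, hd⟩ := hres
    refine ⟨d, ε, hε, h₀.linearMap_ker_eq, fun s _ => (hd s).linearMap_ker_eq, fun s hs => ?_⟩
    have : IsEmpty (Fin (r.choose (s + 1 + 1))) := by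
      rw [Nat.choose_eq_zero_of_lt (by lia)]
      infer_instance
    rw [(hd s).linearMap_ker_eq, LinearMap.range_eq_bot]
    exact Subsingleton.elim _ _
  · refine le_of_projDimLE_of_nontrivial_ext (L := ModuleCat.of _ ℚ) ?_ hn
    obtain ⟨α, hα⟩ := @exists_ne _ hext 0
    refine nontrivial_of_ne ((Ext.mk₀ e.toModuleIso.inv).comp α (zero_add r)) 0 fun h => hα ?_
    have := congrArg (fun β => (Ext.mk₀ e.toModuleIso.hom).comp β (zero_add r)) h
    rwa [Ext.mk₀_comp_mk₀_assoc, Iso.hom_inv_id, Ext.mk₀_id_comp, Ext.comp_zero] at this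
end

section
/- Let r be a natural number, R = ℚ[x_1, …, x_r] the polynomial ring in r variables over ℚ, and regard ℚ as an R-module via evaluation of all variables at 0. Then for every natural number n, Ext^n_R(ℚ, ℚ) is a ℚ-vector space of dimension equal to the binomial coefficient binom(r, n); in particular Ext^n_R(ℚ, ℚ) = 0 for n > r. -/
open CategoryTheory

namespace CategoryTheory.ProjectiveResolution

section

variable {C : Type*} [Category* C] [Abelian C] [HasExt C] {X Y : C} (P : ProjectiveResolution X)

lemma extMk_eq_zero_iff_of_degree_zero (f : P.complex.X 0 ⟶ Y) (m : ℕ) (hm : 0 + 1 = m)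
    (hf : P.complex.d m 0 ≫ f = 0) :
    P.extMk f m hm hf = 0 ↔ f = 0 := by
  refine ⟨fun h ↦ ?_, fun h ↦ by subst h; simp⟩
  rw [← P.extEquivCohomologyClass.apply_eq_iff_eq, extEquivCohomologyClass_extMk,
    extEquivCohomologyClass_zero, CochainComplex.HomComplex.CohomologyClass.mk_eq_zero_iff,
    CochainComplex.HomComplex.Cocycle.toSingleMk_mem_coboundaries_iff _ _ _ _ _ 1 (by simp)] at h
  obtain ⟨g, hg⟩ := h
  have hz : Limits.IsZero (P.cochainComplex.X 1) :=
    CochainComplex.isZero_of_isStrictlyLE _ 0 _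
  rw [hz.eq_of_src g 0, Limits.comp_zero] at hg
  rw [← cancel_epi (P.cochainComplexXIso (-(0 : ℕ)) 0 rfl).hom]
  simpa using hg.symm

lemma smul_extMk (K : Type*) [Ring K] [Linear K C] {n : ℕ} (c : K) (f : P.complex.X n ⟶ Y)
    (m : ℕ) (hm : n + 1 = m) (hf : P.complex.d m n ≫ f = 0) :
    c • P.extMk f m hm hf = P.extMk (c • f) m hm (by simp [hf]) := by
  simp [Abelian.Ext.smul_eq_comp_mk₀, extMk_comp_mk₀]

end

section

variable {C : Type*} [Category* C] [Abelian C] [HasExt C] {X : C} (P : ProjectiveResolution X)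
  (K : Type*) [Ring K] [Linear K C] (Y : C) (n : ℕ)

/-- The class in `Abelian.Ext` of a cocycle of the complex of morphisms out of a projective
resolution. -/
noncomputable def extOfCocycle :
    LinearMap.ker ((P.complex.linearYonedaObj K Y).sc n).g.hom →ₗ[K] Abelian.Ext X Y n where
  toFun z := P.extMk (Y := Y) z.1 ((ComplexShape.up ℕ).next n) (by simp) z.2
  map_add' x y := (P.add_extMk (Y := Y) x.1 y.1 _ _ _ _).symm
  map_smul' c x := (P.smul_extMk (Y := Y) K c x.1 _ _ _).symm

lemma extOfCocycle_surjective : Function.Surjective (P.extOfCocycle K Y n) := by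
  intro x
  obtain ⟨f, hf, rfl⟩ := P.extMk_surjective x ((ComplexShape.up ℕ).next n) (by simp)
  exact ⟨⟨f, hf⟩, rfl⟩

lemma ker_extOfCocycle : LinearMap.ker (P.extOfCocycle K Y n) =
    LinearMap.range ((P.complex.linearYonedaObj K Y).sc n).moduleCatToCycles := by
  ext ⟨f, hf⟩
  have h₁ : (⟨f, hf⟩ : LinearMap.ker ((P.complex.linearYonedaObj K Y).sc n).g.hom) ∈
      LinearMap.range ((P.complex.linearYonedaObj K Y).sc n).moduleCatToCycles ↔
      ∃ g : P.complex.X ((ComplexShape.up ℕ).prev n) ⟶ Y,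
        P.complex.d n ((ComplexShape.up ℕ).prev n) ≫ g = f :=
    exists_congr fun _ ↦ Subtype.ext_iff
  rw [h₁, LinearMap.mem_ker]
  cases n with
  | zero =>
    refine (P.extMk_eq_zero_iff_of_degree_zero (Y := Y) f _ (by simp) hf).trans ?_
    have hd : P.complex.d 0 ((ComplexShape.up ℕ).prev 0) = 0 := P.complex.shape _ _ (by simp)
    simp only [hd, Limits.zero_comp, exists_const_iff]
    exact ⟨fun h ↦ ⟨⟨0⟩, h.symm⟩, fun h ↦ h.2.symm⟩
  | succ m => exact P.extMk_eq_zero_iff (Y := Y) f _ (by simp) hf _ (by simp)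

/-- The derived functor `Ext` agrees with the `Ext`-groups of the derived category. -/
noncomputable def extLinearEquiv [EnoughProjectives C] :
    ((Ext K C n).obj (Opposite.op X)).obj Y ≃ₗ[K] Abelian.Ext X Y n :=
  (P.isoExt n Y ≪≫ ((P.complex.linearYonedaObj K Y).sc n).moduleCatHomologyIso).toLinearEquiv ≪≫ₗ
    Submodule.quotEquivOfEq _ _ (P.ker_extOfCocycle K Y n).symm ≪≫ₗ
    (P.extOfCocycle K Y n).quotKerEquivOfSurjective (P.extOfCocycle_surjective K Y n)

end

end CategoryTheory.ProjectiveResolution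

namespace ModuleCat

variable (K : Type) {R : Type} [Field K] [CommRing R] [Algebra K R]

section

variable {A B Y : ModuleCat.{0} R} {x : R} {g : A ⟶ B} {w : (x • 𝟙 A) ≫ g = 0}

lemma mk₀_smul_id_comp_eq_zero (hY : x • 𝟙 Y = 0) {n : ℕ} (e : Abelian.Ext A Y n) :
    (Abelian.Ext.mk₀ (x • 𝟙 A)).comp e (zero_add n) = 0 := by
  rw [Abelian.Ext.mk₀_smul, Abelian.Ext.smul_comp, Abelian.Ext.mk₀_id_comp,
    Abelian.Ext.smul_eq_comp_mk₀, hY]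
  simp

lemma rank_ext_succ_of_shortExact_smul (hS : (ShortComplex.mk (x • 𝟙 A) g w).ShortExact)
    (hY : x • 𝟙 Y = 0) (n : ℕ) :
    Module.rank K (Abelian.Ext B Y (n + 1)) =
      Module.rank K (Abelian.Ext A Y (n + 1)) + Module.rank K (Abelian.Ext A Y n) := by
  let φ : Abelian.Ext B Y (n + 1) →ₗ[K] Abelian.Ext A Y (n + 1) :=
    Abelian.Ext.bilinearCompOfLinear K A B Y 0 (n + 1) (n + 1) (zero_add _) (Abelian.Ext.mk₀ g)
  let ψ : Abelian.Ext A Y n →ₗ[K] Abelian.Ext B Y (n + 1) :=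
    Abelian.Ext.bilinearCompOfLinear K B A Y 1 n (n + 1) (add_comm _ _) hS.extClass
  have hφ : Function.Surjective φ := fun e ↦
    Abelian.Ext.contravariant_sequence_exact₂ hS Y e (mk₀_smul_id_comp_eq_zero hY e)
  have hψ : Function.Injective ψ := by
    refine (injective_iff_map_eq_zero ψ).2 fun e he ↦ ?_
    obtain ⟨e', rfl⟩ := Abelian.Ext.contravariant_sequence_exact₁ hS Y e (add_comm _ _) he
    exact mk₀_smul_id_comp_eq_zero hY e'
  have hφψ : LinearMap.ker φ = LinearMap.range ψ := by
    ext e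
    refine ⟨fun he ↦ Abelian.Ext.contravariant_sequence_exact₃ hS Y e he (add_comm _ _), ?_⟩
    rintro ⟨e, rfl⟩
    exact hS.comp_extClass_assoc e (add_comm _ _)
  rw [← LinearMap.rank_range_add_rank_ker φ, hφψ, rank_range_of_surjective φ hφ,
    (LinearEquiv.ofInjective ψ hψ).rank_eq]

lemma rank_ext_zero_of_shortExact_smul (hS : (ShortComplex.mk (x • 𝟙 A) g w).ShortExact)
    (hY : x • 𝟙 Y = 0) :
    Module.rank K (Abelian.Ext B Y 0) = Module.rank K (Abelian.Ext A Y 0) := by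
  have : Epi g := hS.epi_g
  let φ : Abelian.Ext B Y 0 →ₗ[K] Abelian.Ext A Y 0 :=
    Abelian.Ext.bilinearCompOfLinear K A B Y 0 0 0 (zero_add _) (Abelian.Ext.mk₀ g)
  exact (LinearEquiv.ofBijective φ ⟨Abelian.Ext.precomp_mk₀_injective_of_epi Y g, fun e ↦
    Abelian.Ext.contravariant_sequence_exact₂ hS Y e (mk₀_smul_id_comp_eq_zero hY e)⟩).rank_eq

end

end ModuleCat

namespace MvPolynomial

variable {σ k : Type} [Field k]

lemma X_mul_mem_span_X_image_iff {s : Set σ} {j : σ} (hj : j ∉ s) {p : MvPolynomial σ k} :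
    X j * p ∈ Ideal.span (X '' s : Set (MvPolynomial σ k)) ↔
      p ∈ Ideal.span (X '' s : Set (MvPolynomial σ k)) := by
  refine ⟨fun h ↦ ?_, Ideal.mul_mem_left _ _⟩
  rw [mem_ideal_span_X_image] at h ⊢
  intro m hm
  obtain ⟨i, hi, hne⟩ := h (Finsupp.single j 1 + m) (by simpa [support_X_mul] using hm)
  refine ⟨i, hi, ?_⟩
  have hij : j ≠ i := fun h ↦ hj (h ▸ hi)
  simpa [Finsupp.single_apply, hij] using hne

variable (k) in
/-- The polynomial ring modulo the variables in `s`, as a module. -/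
noncomputable abbrev quotientVars (s : Set σ) : ModuleCat.{0} (MvPolynomial σ k) :=
  ModuleCat.of _ (MvPolynomial σ k ⧸ Ideal.span (X '' s : Set (MvPolynomial σ k)))

variable (k) in
/-- The projection killing one more variable. -/
noncomputable def quotientVarsInsert (j : σ) (s : Set σ) :
    quotientVars k s ⟶ quotientVars k (insert j s) :=
  ModuleCat.ofHom (Submodule.factor (Ideal.span_mono (Set.image_mono (Set.subset_insert j s))))

lemma X_smul_id_comp_quotientVarsInsert (j : σ) (s : Set σ) :
    ((X j : MvPolynomial σ k) • 𝟙 (quotientVars k s)) ≫ quotientVarsInsert k j s = 0 := by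
  refine ModuleCat.hom_ext (LinearMap.ext fun p ↦ ?_)
  obtain ⟨p, rfl⟩ := Submodule.Quotient.mk_surjective _ p
  refine (Submodule.Quotient.mk_eq_zero _).2 ?_
  exact Ideal.mul_mem_right _ _ (Ideal.subset_span ⟨j, Set.mem_insert _ _, rfl⟩)

lemma shortExact_quotientVarsInsert {j : σ} {s : Set σ} (hj : j ∉ s) :
    (ShortComplex.mk _ _ (X_smul_id_comp_quotientVarsInsert (k := k) j s)).ShortExact := by
  refine ModuleCat.shortComplex_shortExact _ ?_ ?_ ?_
  · intro p
    obtain ⟨p, rfl⟩ := Submodule.Quotient.mk_surjective _ p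
    refine (Submodule.Quotient.mk_eq_zero _).trans ?_
    rw [Set.image_insert_eq, Ideal.mem_span_insert]
    constructor
    · rintro ⟨a, z, hz, rfl⟩
      refine ⟨Submodule.Quotient.mk a, (Submodule.Quotient.eq _).2 ?_⟩
      simpa [mul_comm] using hz
    · rintro ⟨q, hq⟩
      obtain ⟨q, rfl⟩ := Submodule.Quotient.mk_surjective _ q
      refine ⟨q, _, (Submodule.Quotient.eq _).1 hq.symm, ?_⟩
      simp [mul_comm]
  · refine (injective_iff_map_eq_zero _).2 fun p hp ↦ ?_
    obtain ⟨p, rfl⟩ := Submodule.Quotient.mk_surjective _ p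
    exact (Submodule.Quotient.mk_eq_zero _).2
      ((X_mul_mem_span_X_image_iff hj).1 ((Submodule.Quotient.mk_eq_zero _).1 hp))
  · exact Submodule.factor_surjective (Ideal.span_mono (Set.image_mono (Set.subset_insert j s)))

theorem rank_ext_quotientVars (Y : ModuleCat.{0} (MvPolynomial σ k))
    (hY : ∀ j, (X j : MvPolynomial σ k) • 𝟙 Y = 0)
    (hrank : Module.rank k (ModuleCat.of (MvPolynomial σ k) (MvPolynomial σ k) ⟶ Y) = 1)
    (s : Finset σ) (n : ℕ) :
    Module.rank k (Abelian.Ext (quotientVars k (s : Set σ)) Y n) = (s.card.choose n : Cardinal) := by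
  classical
  induction s using Finset.induction_on generalizing n with
  | empty =>
    let e : quotientVars k ((∅ : Finset σ) : Set σ) ≅
        ModuleCat.of (MvPolynomial σ k) (MvPolynomial σ k) :=
      (Submodule.quotEquivOfEqBot _ (by simp)).toModuleIso
    cases n with
    | zero =>
      rw [Abelian.Ext.linearEquiv₀ (R := k).rank_eq, (Linear.homCongr k e (Iso.refl Y)).rank_eq,
        hrank]
      simp
    | succ n =>
      have : Projective (quotientVars k ((∅ : Finset σ) : Set σ)) :=
        Projective.of_iso e.symm (ModuleCat.projective_of_free (Module.Basis.singleton Unit _))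
      have := Abelian.Ext.subsingleton_of_projective (quotientVars k ((∅ : Finset σ) : Set σ)) Y n
      simp
  | insert j s hj ih =>
    have hS := shortExact_quotientVarsInsert (k := k) (j := j) (s := (s : Set σ)) (by simpa using hj)
    rw [Finset.coe_insert, Finset.card_insert_of_notMem hj]
    cases n with
    | zero => rw [ModuleCat.rank_ext_zero_of_shortExact_smul k hS (hY j), ih]; simp
    | succ n =>
      rw [ModuleCat.rank_ext_succ_of_shortExact_smul k hS (hY j), ih, ih, Nat.choose_succ_succ]
      push_cast
      rw [add_comm]

end MvPolynomial

lemma MvPolynomial.ker_toSpanSingleton_one_eq {r : ℕ} :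
    letI := qModule r
    LinearMap.ker (LinearMap.toSpanSingleton (MvPolynomial (Fin r) ℚ) ℚ 1) =
      Ideal.span (X '' (Finset.univ : Finset (Fin r))) := by
  let := qModule r
  ext p
  have h : (LinearMap.toSpanSingleton (MvPolynomial (Fin r) ℚ) ℚ 1) p = coeff 0 p := by
    have : p • (1 : ℚ) = eval 0 p * 1 := rfl
    simp [this, ← constantCoeff_eq, eval_zero]
  rw [LinearMap.mem_ker, h, mem_ideal_span_X_image]
  constructor
  · intro hp m hm
    by_contra! hm'
    obtain rfl : m = 0 := Finsupp.ext fun i ↦ hm' i (by simp)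
    exact mem_support_iff.1 hm hp
  · intro hp
    by_contra hp'
    obtain ⟨i, -, hi⟩ := hp 0 (mem_support_iff.2 hp')
    exact hi rfl

/-- Let `R = ℚ[x_1, …, x_r]` and regard `ℚ` as an `R`-module via
evaluation at `0`.  For every `n`, the `ℚ`-vector space `Ext^n_R(ℚ, ℚ)` has dimension
`binom(r, n)`; in particular it vanishes for `n > r`. -/
theorem stmt5 (r n : ℕ) :
    letI R := MvPolynomial (Fin r) ℚ
    letI : Module R ℚ := qModule r
    Module.rank ℚ
        (((Ext ℚ (ModuleCat R) n).obj
            (Opposite.op (ModuleCat.of R ℚ))).obj (ModuleCat.of R ℚ)) =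
      (r.choose n : Cardinal) ∧
    (r < n →
      Subsingleton
        (((Ext ℚ (ModuleCat R) n).obj
            (Opposite.op (ModuleCat.of R ℚ))).obj (ModuleCat.of R ℚ))) := by
  let : Module (MvPolynomial (Fin r) ℚ) ℚ := qModule r
  let Y := ModuleCat.of (MvPolynomial (Fin r) ℚ) ℚ
  let ev := LinearMap.toSpanSingleton (MvPolynomial (Fin r) ℚ) ℚ 1
  have hev : Function.Surjective ev := fun q ↦ ⟨MvPolynomial.C q, by
    change MvPolynomial.eval 0 (MvPolynomial.C q) * 1 = q
    simp⟩
  let e : MvPolynomial.quotientVars ℚ ((Finset.univ : Finset (Fin r)) : Set (Fin r)) ≅ Y :=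
    (Submodule.quotEquivOfEq _ _ MvPolynomial.ker_toSpanSingleton_one_eq.symm ≪≫ₗ
      ev.quotKerEquivOfSurjective hev).toModuleIso
  have hY (j : Fin r) : (MvPolynomial.X j : MvPolynomial (Fin r) ℚ) • 𝟙 Y = 0 := by
    refine ModuleCat.hom_ext (LinearMap.ext fun q ↦ ?_)
    change MvPolynomial.eval 0 (MvPolynomial.X j) * q = (0 : ℚ)
    simp
  let : Module ℚ (ModuleCat.of (MvPolynomial (Fin r) ℚ) (MvPolynomial (Fin r) ℚ) ⟶ Y) :=
    Linear.homModule _ _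
  let f : (ModuleCat.of (MvPolynomial (Fin r) ℚ) (MvPolynomial (Fin r) ℚ) ⟶ Y) ≃+ ℚ :=
    ModuleCat.homAddEquiv.trans
      (LinearMap.ringLmapEquivSelf (MvPolynomial (Fin r) ℚ) ℕ ℚ).toAddEquiv
  have hrank : Module.rank ℚ (((Ext ℚ (ModuleCat (MvPolynomial (Fin r) ℚ)) n).obj
      (Opposite.op Y)).obj Y) = (r.choose n : Cardinal) := by
    rw [(((Ext ℚ (ModuleCat (MvPolynomial (Fin r) ℚ)) n).mapIso e.op).app Y).toLinearEquiv.rank_eq,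
      ((projectiveResolution _).extLinearEquiv ℚ Y n).rank_eq,
      MvPolynomial.rank_ext_quotientVars Y hY
        ((f.toLinearEquiv (map_rat_smul f)).rank_eq.trans (Module.rank_self ℚ)),
      Finset.card_univ, Fintype.card_fin]
  refine ⟨hrank, fun h ↦ ?_⟩
  rwa [Nat.choose_eq_zero_of_lt h, Nat.cast_zero, rank_zero_iff] at hrank
end
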